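/- For natural numbers k ≥ 1 and ℓ ≥ 1, let G_{k,ℓ} be the directed graph with vertex set {a₁,…,a_k} ∪ {p₁,…,p_ℓ} ∪ {b₁,…,b_k} and arcs: aᵢ → a_j for all i ≠ j; bᵢ → b_j for all i ≠ j; aᵢ → p₁ for all i; pᵢ → p_{i+1} for 1 ≤ i < ℓ; and p_ℓ → b_j for all j. Let N(t) be the number of ordered pairs (x, y) of vertices with y reachable from x in at most t steps. Then N(0) = 2k + ℓ; for 1 ≤ t ≤ ℓ, 2·N(t) = (t+1)·(4k + 2ℓ − t) − 4k + 4k² (i.e., N(t) = (t+1)(2k + ℓ − t/2) − 2k + 2k²); and for t > ℓ, 2·N(t) = (ℓ+1)·(4k + ℓ) − 4k + 6k² (i.e., N(t) = (ℓ+1)(2k + ℓ/2) − 2k + 3k²). -/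

import Mathlib

/-- The ball of radius `r` around `x` in the directed graph with arc relation `E`:
the set of vertices reachable from `x` along `E` in at most `r` steps. -/
def ball {V : Type*} (E : V → V → Prop) (x : V) (r : ℕ) : Set V :=
  {y | ∃ k ≤ r, ∃ v : ℕ → V, v 0 = x ∧ v k = y ∧ ∀ i < k, E (v i) (v (i + 1))}

/-- The arc relation of the graph `G_{k,ℓ}` of the paper: two `k`-cliques
(`Sum.inl` and `Sum.inr ∘ Sum.inr`) joined by a unidirectional path of `ℓ` nodes
(`Sum.inr ∘ Sum.inl`, with `p₁` corresponding to index `0` and `p_ℓ` to index `ℓ - 1`). -/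
def Gkl (k l : ℕ) : (Fin k ⊕ Fin l ⊕ Fin k) → (Fin k ⊕ Fin l ⊕ Fin k) → Prop
  | Sum.inl i, Sum.inl j => i ≠ j
  | Sum.inl _, Sum.inr (Sum.inl p) => (p : ℕ) = 0
  | Sum.inr (Sum.inl p), Sum.inr (Sum.inl q) => (q : ℕ) = (p : ℕ) + 1
  | Sum.inr (Sum.inl p), Sum.inr (Sum.inr _) => (p : ℕ) = l - 1
  | Sum.inr (Sum.inr i), Sum.inr (Sum.inr j) => i ≠ j
  | _, _ => False

/-- The neighbourhood function of `G_{k,ℓ}`: the number of ordered pairs `(x, y)` of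
vertices with `y` reachable from `x` in at most `t` steps. -/
noncomputable def NGkl (k l t : ℕ) : ℕ :=
  {p : (Fin k ⊕ Fin l ⊕ Fin k) × (Fin k ⊕ Fin l ⊕ Fin k) |
    p.2 ∈ ball (Gkl k l) p.1 t}.ncard

/-- The position of a vertex of `G_{k,ℓ}` along the path: the first clique is at position `0`,
the path nodes are at positions `1, …, ℓ`, and the second clique is at position `ℓ + 1`. -/
def gklPos (k l : ℕ) : Fin k ⊕ Fin l ⊕ Fin k → ℕ
  | Sum.inl _ => 0
  | Sum.inr (Sum.inl p) => (p : ℕ) + 1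
  | Sum.inr (Sum.inr _) => l + 1

theorem gkl_iff_gklPos {k l : ℕ} (hl : 1 ≤ l) (x y : Fin k ⊕ Fin l ⊕ Fin k) :
    Gkl k l x y ↔ gklPos k l y = gklPos k l x + 1 ∨ (gklPos k l x = gklPos k l y ∧ x ≠ y) := by
  rcases x with x | x | x <;> rcases y with y | y | y <;>
    simp [Gkl, gklPos] <;> grind

theorem exists_gklPos_eq {k l : ℕ} (hk : 1 ≤ k) {c : ℕ} (hc : c ≤ l + 1) :
    ∃ x, gklPos k l x = c := by
  rcases Nat.eq_zero_or_pos c with rfl | h0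
  · exact ⟨Sum.inl ⟨0, hk⟩, rfl⟩
  · rcases hc.eq_or_lt with rfl | h1
    · exact ⟨Sum.inr (Sum.inr ⟨0, hk⟩), rfl⟩
    · exact ⟨Sum.inr (Sum.inl ⟨c - 1, by omega⟩), by simp only [gklPos]; omega⟩

theorem gklPos_le (k l : ℕ) (x : Fin k ⊕ Fin l ⊕ Fin k) : gklPos k l x ≤ l + 1 := by
  rcases x with x | x | x <;> simp only [gklPos] <;> omega

theorem mem_ball_zero {V : Type*} (E : V → V → Prop) (x y : V) : y ∈ ball E x 0 ↔ x = y := by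
  constructor
  · rintro ⟨n, hn, v, rfl, rfl, -⟩
    rw [Nat.le_zero.mp hn]
  · rintro rfl
    exact ⟨0, le_rfl, fun _ => x, rfl, rfl, by simp⟩

theorem mem_ball_gkl {k l t : ℕ} (hk : 1 ≤ k) (hl : 1 ≤ l) (ht : 1 ≤ t)
    (x y : Fin k ⊕ Fin l ⊕ Fin k) :
    y ∈ ball (Gkl k l) x t ↔
      gklPos k l x ≤ gklPos k l y ∧ gklPos k l y ≤ gklPos k l x + t := by
  constructor
  · rintro ⟨n, hn, v, rfl, rfl, hv⟩
    have key : ∀ i ≤ n, gklPos k l (v 0) ≤ gklPos k l (v i) ∧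
        gklPos k l (v i) ≤ gklPos k l (v 0) + i := by
      intro i
      induction i with
      | zero => simp
      | succ i ih =>
        intro hi
        have h1 := ih (by omega)
        have h2 := (gkl_iff_gklPos hl _ _).mp (hv i (by omega))
        omega
    have := key n le_rfl
    omega
  · rintro ⟨h1, h2⟩
    rcases h1.eq_or_lt with h1 | h1
    · by_cases hxy : x = y
      · exact ⟨0, by omega, fun _ => x, rfl, hxy, by simp⟩
      · refine ⟨1, ht, fun i => if i = 0 then x else y, by simp, by simp, fun i hi => ?_⟩
        obtain rfl : i = 0 := by omega
        simpa using (gkl_iff_gklPos hl x y).mpr (Or.inr ⟨h1, hxy⟩)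
    · have hy := gklPos_le k l y
      have hw : ∀ c, ∃ z, c ≤ l + 1 → gklPos k l z = c := by
        intro c
        by_cases hc : c ≤ l + 1
        · obtain ⟨z, hz⟩ := exists_gklPos_eq hk hc
          exact ⟨z, fun _ => hz⟩
        · exact ⟨x, fun h => absurd h hc⟩
      choose w hw using hw
      obtain ⟨n, hn⟩ := Nat.exists_eq_add_of_lt h1
      let v : ℕ → Fin k ⊕ Fin l ⊕ Fin k := fun m =>
        if m = 0 then x else if m = n + 1 then y else w (gklPos k l x + m)
      have hv : ∀ m ≤ n + 1, gklPos k l (v m) = gklPos k l x + m := by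
        intro m hm
        by_cases h0 : m = 0
        · simp [v, h0]
        by_cases h1 : m = n + 1
        · simp [v, h1]
          omega
        · simp only [v, h0, h1, if_false]
          exact hw _ (by omega)
      refine ⟨n + 1, by omega, v, by simp [v], by simp [v], fun i hi => ?_⟩
      rw [gkl_iff_gklPos hl, hv i (by omega), hv (i + 1) (by omega)]
      left
      omega

theorem sum_ite_lt_eq_min (l t : ℕ) :
    (∑ q : Fin l, if (q : ℕ) < t then 1 else 0) = min l t := by
  rw [Fin.sum_univ_eq_sum_range (fun q => if q < t then 1 else 0)]
  induction l with
  | zero => simp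
  | succ l ih => rw [Finset.sum_range_succ, ih]; split_ifs <;> omega

theorem sum_ite_le_add_eq_min (l t : ℕ) :
    (∑ q : Fin l, if l ≤ (q : ℕ) + t then 1 else 0) = min l t := by
  rw [← sum_ite_lt_eq_min, ← Equiv.sum_comp Fin.revPerm]
  refine Finset.sum_congr rfl fun q _ => ?_
  have := q.isLt
  simp only [Fin.revPerm_apply, Fin.val_rev]
  split_ifs <;> omega

theorem sum_ite_band (l t : ℕ) :
    (∑ p : Fin l, ∑ q : Fin l, if (p : ℕ) ≤ q ∧ (q : ℕ) ≤ p + t then 1 else 0) =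
      ∑ j ∈ Finset.range l, (min j t + 1) := by
  rw [Finset.sum_comm, ← Fin.sum_univ_eq_sum_range (fun j => min j t + 1)]
  refine Finset.sum_congr rfl fun q _ => ?_
  have hq := q.isLt
  rw [Fin.sum_univ_eq_sum_range (fun p => if p ≤ (q : ℕ) ∧ (q : ℕ) ≤ p + t then 1 else 0),
    ← Finset.card_filter]
  have : (Finset.range l).filter (fun p => p ≤ (q : ℕ) ∧ (q : ℕ) ≤ p + t) =
      Finset.Icc ((q : ℕ) - t) q := by
    ext p
    simp only [Finset.mem_filter, Finset.mem_range, Finset.mem_Icc]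
    omega
  rw [this, Nat.card_Icc]
  omega

theorem two_mul_sum_min_of_le_add_one {l t : ℕ} (h : l ≤ t + 1) :
    2 * ∑ j ∈ Finset.range l, (min j t + 1) = l * (l + 1) := by
  induction l with
  | zero => simp
  | succ l ih =>
    rw [Finset.sum_range_succ, mul_add, ih (by omega), min_eq_left (by omega)]
    ring

theorem two_mul_sum_min_of_le {l t : ℕ} (h : t ≤ l) :
    2 * ((∑ j ∈ Finset.range l, (min j t + 1) : ℕ) : ℤ) = ((t : ℤ) + 1) * (2 * l - t) := by
  induction l, h using Nat.le_induction with
  | base =>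
    have := two_mul_sum_min_of_le_add_one (Nat.le_succ t)
    zify at this
    push_cast
    linear_combination this
  | succ l h ih =>
    rw [Finset.sum_range_succ, min_eq_right h]
    push_cast at ih ⊢
    linear_combination ih

theorem NGkl_zero (k l : ℕ) : NGkl k l 0 = 2 * k + l := by
  have : {p : (Fin k ⊕ Fin l ⊕ Fin k) × (Fin k ⊕ Fin l ⊕ Fin k) |
      p.2 ∈ ball (Gkl k l) p.1 0} = Set.range fun x => (x, x) := by
    ext ⟨x, y⟩
    simp [mem_ball_zero]
  rw [NGkl, this, ← Set.image_univ,
    Set.ncard_image_of_injective _ (fun x y h => (Prod.ext_iff.mp h).1),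
    Set.ncard_univ]
  simp
  ring

theorem NGkl_eq_of_pos {k l t : ℕ} (hk : 1 ≤ k) (hl : 1 ≤ l) (ht : 1 ≤ t) :
    NGkl k l t = 2 * k ^ 2 + 2 * k * min l t + ∑ j ∈ Finset.range l, (min j t + 1) +
      if l < t then k ^ 2 else 0 := by
  have h : NGkl k l t = ∑ x, ∑ y,
      if gklPos k l x ≤ gklPos k l y ∧ gklPos k l y ≤ gklPos k l x + t then 1 else 0 := by
    simp_rw [NGkl, mem_ball_gkl hk hl ht]
    rw [← Fintype.sum_prod_type', ← Finset.card_filter, ← Set.ncard_coe_finset]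
    simp
  have hap : ∀ q : Fin l, (q : ℕ) + 1 ≤ t ↔ (q : ℕ) < t := fun q => Iff.rfl
  have hpp : ∀ p q : Fin l, (q : ℕ) + 1 ≤ p + 1 + t ↔ (q : ℕ) ≤ p + t := fun p q => by omega
  have hpb : ∀ p : Fin l, l + 1 ≤ (p : ℕ) + 1 + t ↔ l ≤ (p : ℕ) + t := fun p => by omega
  have hpl : ∀ p : Fin l, (p : ℕ) ≤ l := fun p => p.isLt.le
  have hpa : ∀ p : Fin l, ¬ (l + 1 ≤ (p : ℕ) + 1) := fun p => by have := p.isLt; omega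
  rw [h]
  simp only [Fintype.sum_sum_type, gklPos, hpp, hpb, hpl, hpa, Finset.sum_add_distrib, zero_add,
    Nat.add_le_add_iff_right, sum_ite_band, Nat.zero_le, true_and, false_and, hap,
    sum_ite_lt_eq_min, Finset.sum_const, Finset.card_univ, Fintype.card_fin, smul_eq_mul,
    ← Finset.mul_sum, sum_ite_le_add_eq_min]
  simp
  split_ifs <;> ring

/-- The exact neighbourhood function of the graph `G_{k,ℓ}`:
`N(0) = 2k + ℓ`; for `1 ≤ t ≤ ℓ`, `2N(t) = (t+1)(4k + 2ℓ − t) − 4k + 4k²`;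
and for `t > ℓ`, `2N(t) = (ℓ+1)(4k + ℓ) − 4k + 6k²`. -/
theorem NGkl_formula (k l : ℕ) (hk : 1 ≤ k) (hl : 1 ≤ l) :
    (NGkl k l 0 = 2 * k + l) ∧
    (∀ t : ℕ, 1 ≤ t → t ≤ l →
      2 * (NGkl k l t : ℤ) =
        ((t : ℤ) + 1) * (4 * k + 2 * l - t) - 4 * k + 4 * (k : ℤ) ^ 2) ∧
    (∀ t : ℕ, l < t →
      2 * (NGkl k l t : ℤ) =
        ((l : ℤ) + 1) * (4 * k + l) - 4 * k + 6 * (k : ℤ) ^ 2) := by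
  refine ⟨NGkl_zero k l, fun t ht htl => ?_, fun t ht => ?_⟩
  · have h := two_mul_sum_min_of_le htl
    rw [NGkl_eq_of_pos hk hl ht, if_neg (by omega), min_eq_right htl]
    push_cast at h ⊢
    linear_combination h
  · have h := two_mul_sum_min_of_le_add_one (show l ≤ t + 1 by omega)
    rw [NGkl_eq_of_pos hk hl (by omega), if_pos ht, min_eq_left ht.le]
    zify at h
    push_cast
    linear_combination h
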